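/- arXiv:1109.1913 — 9 statements merged into one kernel-verified Lean document; each statement's English description precedes it below -/
import Mathlib

section
/- Let r > 0 and Δ ≥ 0 be real numbers. There exists an (r,Δ)-identifying code C ⊆ ℤ² if and only if the set S_{r,Δ}((0,0),(−1,0)) is nonempty. -/
open Filter

def ball (r : ℝ) (u : ℤ × ℤ) : Set (ℤ × ℤ) :=
  {v : ℤ × ℤ | ((v.1 - u.1 : ℤ) : ℝ) ^ 2 + ((v.2 - u.2 : ℤ) : ℝ) ^ 2 ≤ r ^ 2}

def Spat (r Δ : ℝ) (u v : ℤ × ℤ) : Set (ℤ × ℤ) :=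
  (ball r u \ ball (r + Δ) v) ∪ (ball r v \ ball (r + Δ) u)

def IsIdCode (r Δ : ℝ) (C : Set (ℤ × ℤ)) : Prop :=
  (∀ u : ℤ × ℤ, (ball r u ∩ C).Nonempty) ∧
    ∀ u v : ℤ × ℤ, u ≠ v → (Spat r Δ u v ∩ C).Nonempty

def Qset (n : ℕ) : Set (ℤ × ℤ) := {p : ℤ × ℤ | |p.1| ≤ (n : ℤ) ∧ |p.2| ≤ (n : ℤ)}

noncomputable def density (C : Set (ℤ × ℤ)) : ℝ :=
  Filter.limsup
    (fun n : ℕ => (Nat.card ↥(C ∩ Qset n) : ℝ) / ((2 * (n : ℝ) + 1) ^ 2))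
    Filter.atTop

def IntersectsDiagMod (U : Set (ℤ × ℤ)) (k : ℕ) : Prop :=
  ∀ i : ℤ, ∃ p ∈ U, Int.ModEq (k : ℤ) (p.2 - p.1) i

def IntersectsAntiDiagMod (U : Set (ℤ × ℤ)) (k : ℕ) : Prop :=
  ∀ i : ℤ, ∃ p ∈ U, Int.ModEq (k : ℤ) (p.1 + p.2) i

def IntersectsHorizMod (U : Set (ℤ × ℤ)) (k : ℕ) : Prop :=
  ∀ i : ℤ, ∃ p ∈ U, Int.ModEq (k : ℤ) p.2 i

noncomputable def diagNum (U : Set (ℤ × ℤ)) : ℕ :=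
  sSup {k : ℕ | 0 < k ∧ IntersectsDiagMod U k}

def Lv (k : ℕ) : Set (ℤ × ℤ) := {p : ℤ × ℤ | (k : ℤ) ∣ p.1}
def Lh (k : ℕ) : Set (ℤ × ℤ) := {p : ℤ × ℤ | (k : ℤ) ∣ p.2}
def Ld (k : ℕ) : Set (ℤ × ℤ) := {p : ℤ × ℤ | (k : ℤ) ∣ (p.2 - p.1)}

/-- An integer of absolute value `n` with the same sign as `a` is moved away from `0` by `a`. -/
theorem exists_sq_eq_and_le_add_sq (n a : ℤ) (hn : 0 ≤ n) :
    ∃ p : ℤ, p ^ 2 = n ^ 2 ∧ n ^ 2 ≤ (p + a) ^ 2 ∧ (a ≠ 0 → (n + 1) ^ 2 ≤ (p + a) ^ 2) := by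
  rcases le_or_gt 0 a with ha | ha
  · refine ⟨n, rfl, by nlinarith, fun h => ?_⟩
    have : 1 ≤ a := by omega
    nlinarith
  · refine ⟨-n, by ring, by nlinarith, fun _ => ?_⟩
    have : a ≤ -1 := by omega
    nlinarith

theorem exists_norm_eq_and_le_translate (x y : ℤ) (hx : 0 ≤ x) (w : ℤ × ℤ) (hw : w ≠ 0) :
    ∃ p q : ℤ, p ^ 2 + q ^ 2 = x ^ 2 + y ^ 2 ∧
      (x + 1) ^ 2 + y ^ 2 ≤ (p + w.1) ^ 2 + (q + w.2) ^ 2 := by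
  by_cases h : w.1 = 0
  · have h2 : w.2 ≠ 0 := fun h2 => hw (Prod.ext h h2)
    obtain ⟨p, hp, hp', -⟩ := exists_sq_eq_and_le_add_sq |y| w.1 (abs_nonneg y)
    obtain ⟨q, hq, -, hq'⟩ := exists_sq_eq_and_le_add_sq x w.2 hx
    rw [sq_abs] at hp hp'
    exact ⟨p, q, by linarith, by linarith [hq' h2]⟩
  · obtain ⟨p, hp, -, hp'⟩ := exists_sq_eq_and_le_add_sq x w.1 hx
    obtain ⟨q, hq, hq', -⟩ := exists_sq_eq_and_le_add_sq |y| w.2 (abs_nonneg y)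
    rw [sq_abs] at hq hq'
    exact ⟨p, q, by linarith, by linarith [hp' h]⟩

theorem mem_ball_iff {r : ℝ} {u v : ℤ × ℤ} :
    v ∈ ball r u ↔ (((v.1 - u.1) ^ 2 + (v.2 - u.2) ^ 2 : ℤ) : ℝ) ≤ r ^ 2 := by
  simp [ball]

theorem exists_of_Spat_nonempty {r Δ : ℝ} (hr : 0 < r) (hΔ : 0 ≤ Δ)
    (h : (Spat r Δ ((0, 0) : ℤ × ℤ) ((-1, 0) : ℤ × ℤ)).Nonempty) :
    ∃ x y : ℤ, 0 ≤ x ∧ ((x ^ 2 + y ^ 2 : ℤ) : ℝ) ≤ r ^ 2 ∧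
      (r + Δ) ^ 2 < (((x + 1) ^ 2 + y ^ 2 : ℤ) : ℝ) := by
  have key : ∀ x y : ℤ, ((x ^ 2 + y ^ 2 : ℤ) : ℝ) ≤ r ^ 2 →
      (r + Δ) ^ 2 < (((x + 1) ^ 2 + y ^ 2 : ℤ) : ℝ) → 0 ≤ x := by
    intro x y h1 h2
    have h3 : r ^ 2 ≤ (r + Δ) ^ 2 := by gcongr; linarith
    have h4 : x ^ 2 + y ^ 2 < (x + 1) ^ 2 + y ^ 2 := by
      exact_mod_cast (h1.trans h3).trans_lt h2
    nlinarith
  obtain ⟨⟨x, y⟩, ⟨h1, h2⟩ | ⟨h1, h2⟩⟩ := h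
  · rw [mem_ball_iff] at h1 h2
    simp only [sub_zero, sub_neg_eq_add, not_le] at h1 h2
    exact ⟨x, y, key x y h1 h2, h1, h2⟩
  · rw [mem_ball_iff] at h1 h2
    simp only [sub_zero, sub_neg_eq_add, not_le] at h1 h2
    rw [show (x + 1) ^ 2 = (-1 - x) ^ 2 by ring] at h1
    rw [show x ^ 2 = (-1 - x + 1) ^ 2 by ring] at h2
    exact ⟨-1 - x, y, key _ y h1 h2, h1, h2⟩

theorem Spat_nonempty_of_ne {r Δ : ℝ} (hr : 0 < r) (hΔ : 0 ≤ Δ)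
    (h : (Spat r Δ ((0, 0) : ℤ × ℤ) ((-1, 0) : ℤ × ℤ)).Nonempty) {u v : ℤ × ℤ} (huv : u ≠ v) :
    (Spat r Δ u v).Nonempty := by
  obtain ⟨x, y, hx, h1, h2⟩ := exists_of_Spat_nonempty hr hΔ h
  obtain ⟨p, q, hpq, hle⟩ := exists_norm_eq_and_le_translate x y hx (u - v) (sub_ne_zero.2 huv)
  refine ⟨(p + u.1, q + u.2), Or.inl ⟨?_, ?_⟩⟩
  · rw [mem_ball_iff]
    simpa only [add_sub_cancel_right, hpq] using h1
  · rw [mem_ball_iff, not_le]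
    refine h2.trans_le (Int.cast_le.2 ?_)
    simpa only [add_sub_assoc, Prod.fst_sub, Prod.snd_sub] using hle

theorem stmt0 (r Δ : ℝ) (hr : 0 < r) (hΔ : 0 ≤ Δ) :
    (∃ C : Set (ℤ × ℤ), IsIdCode r Δ C) ↔
      (Spat r Δ ((0, 0) : ℤ × ℤ) ((-1, 0) : ℤ × ℤ)).Nonempty := by
  constructor
  · rintro ⟨C, -, hC⟩
    exact (hC (0, 0) (-1, 0) (by simp)).mono Set.inter_subset_left
  · refine fun h => ⟨Set.univ, fun u => ⟨u, ?_, trivial⟩, fun u v huv => ?_⟩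
    · rw [mem_ball_iff]
      simpa using sq_nonneg r
    · simpa only [Set.inter_univ] using Spat_nonempty_of_ne hr hΔ h huv
end

section
/- Let r ≥ 2 be a real number and let Δ ≥ 0 be a real number satisfying (r+Δ)² < r² + 2r − 2√(2r). Then the set S_{r,Δ}((0,0),(−1,0)) is nonempty; more precisely, the vertex u = (⌊r⌋, ⌊√(r² − ⌊r⌋²)⌋) belongs to B_r((0,0)) ∖ B_{r+Δ}((−1,0)). Consequently an (r,Δ)-identifying code exists. -/
open Filter

/-- The corner point of the ball of radius `r` at the origin lies in the ball and far from `(-1, 0)`. -/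
theorem corner_bounds {r : ℝ} (hr : 2 ≤ r) :
    0 ≤ ⌊r⌋ ∧ 0 ≤ ⌊Real.sqrt (r ^ 2 - (⌊r⌋ : ℝ) ^ 2)⌋ ∧
      (⌊r⌋ : ℝ) ^ 2 + (⌊Real.sqrt (r ^ 2 - (⌊r⌋ : ℝ) ^ 2)⌋ : ℝ) ^ 2 ≤ r ^ 2 ∧
      r ^ 2 + 2 * r - 2 * Real.sqrt (2 * r) ≤
        ((⌊r⌋ : ℝ) + 1) ^ 2 + (⌊Real.sqrt (r ^ 2 - (⌊r⌋ : ℝ) ^ 2)⌋ : ℝ) ^ 2 := by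
  have ha : 0 ≤ ⌊r⌋ := Int.floor_nonneg.2 (by linarith)
  have ha' : (0 : ℝ) ≤ ⌊r⌋ := by exact_mod_cast ha
  have hle := Int.floor_le r
  have hlt := Int.lt_floor_add_one r
  generalize (⌊r⌋ : ℝ) = a at *
  have hs2 : 0 ≤ r ^ 2 - a ^ 2 := by nlinarith
  have hs := Real.sqrt_nonneg (r ^ 2 - a ^ 2)
  have hsq := Real.sq_sqrt hs2
  have hst : Real.sqrt (r ^ 2 - a ^ 2) ≤ Real.sqrt (2 * r) :=
    Real.sqrt_le_sqrt (by nlinarith)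
  have ht : 1 ≤ Real.sqrt (2 * r) := Real.one_le_sqrt.2 (by linarith)
  have hb : 0 ≤ ⌊Real.sqrt (r ^ 2 - a ^ 2)⌋ := Int.floor_nonneg.2 hs
  refine ⟨ha, hb, ?_⟩
  have hb' : (0 : ℝ) ≤ ⌊Real.sqrt (r ^ 2 - a ^ 2)⌋ := by exact_mod_cast hb
  have hble := Int.floor_le (Real.sqrt (r ^ 2 - a ^ 2))
  have hblt := Int.lt_floor_add_one (Real.sqrt (r ^ 2 - a ^ 2))
  generalize (⌊Real.sqrt (r ^ 2 - a ^ 2)⌋ : ℝ) = b at *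
  generalize Real.sqrt (r ^ 2 - a ^ 2) = s at *
  refine ⟨by nlinarith, ?_⟩
  rcases le_total 1 s with h1 | h1 <;> nlinarith

/-- After a suitable reflection, `a` is at distance at least `a` from `-p`, and at least `a + 1` if `p ≠ 0`. -/
theorem exists_sq_eq_le_sq_add {a : ℤ} (ha : 0 ≤ a) (p : ℤ) :
    ∃ x : ℤ, x ^ 2 = a ^ 2 ∧ a ^ 2 ≤ (x + p) ^ 2 ∧ (p ≠ 0 → (a + 1) ^ 2 ≤ (x + p) ^ 2) := by
  rcases le_total 0 p with hp | hp
  · refine ⟨a, rfl, by nlinarith, fun h => ?_⟩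
    have : 1 ≤ p := by omega
    nlinarith
  · refine ⟨-a, by ring, by nlinarith, fun h => ?_⟩
    have : p ≤ -1 := by omega
    nlinarith

theorem exists_far_point {a b : ℤ} (ha : 0 ≤ a) (hb : 0 ≤ b) {d : ℤ × ℤ} (hd : d ≠ 0) :
    ∃ x y : ℤ, x ^ 2 + y ^ 2 = a ^ 2 + b ^ 2 ∧
      (a + 1) ^ 2 + b ^ 2 ≤ (x + d.1) ^ 2 + (y + d.2) ^ 2 := by
  by_cases hp : d.1 = 0
  · have hq : d.2 ≠ 0 := fun hq => hd (Prod.ext hp hq)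
    obtain ⟨x, hx, hx', -⟩ := exists_sq_eq_le_sq_add hb d.1
    obtain ⟨y, hy, -, hy'⟩ := exists_sq_eq_le_sq_add ha d.2
    exact ⟨x, y, by linarith, by linarith [hy' hq]⟩
  · obtain ⟨x, hx, -, hx'⟩ := exists_sq_eq_le_sq_add ha d.1
    obtain ⟨y, hy, hy', -⟩ := exists_sq_eq_le_sq_add hb d.2
    exact ⟨x, y, by linarith, by linarith [hx' hp]⟩

theorem Spat_nonempty {r Δ : ℝ} (hr : 2 ≤ r)
    (h : (r + Δ) ^ 2 < r ^ 2 + 2 * r - 2 * Real.sqrt (2 * r)) {u v : ℤ × ℤ} (huv : u ≠ v) :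
    (Spat r Δ u v).Nonempty := by
  obtain ⟨ha, hb, hin, hout⟩ := corner_bounds hr
  obtain ⟨x, y, hxy, hfar⟩ := exists_far_point ha hb (sub_ne_zero.2 huv)
  refine ⟨(u.1 + x, u.2 + y), Or.inl ⟨?_, fun hmem => ?_⟩⟩
  · have hxy' := congrArg (Int.cast : ℤ → ℝ) hxy
    push_cast at hxy'
    simp only [ball, Set.mem_ofPred_eq]
    push_cast
    linarith
  · have hfar' := (Int.cast_le (R := ℝ)).2 hfar
    simp only [ball, Set.mem_ofPred_eq] at hmem
    push_cast [Prod.fst_sub, Prod.snd_sub] at hfar' hmem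
    linarith

theorem stmt1 (r Δ : ℝ) (hr : 2 ≤ r) (hΔ : 0 ≤ Δ)
    (h : (r + Δ) ^ 2 < r ^ 2 + 2 * r - 2 * Real.sqrt (2 * r)) :
    ((⌊r⌋, ⌊Real.sqrt (r ^ 2 - (⌊r⌋ : ℝ) ^ 2)⌋) : ℤ × ℤ) ∈
        ball r ((0, 0) : ℤ × ℤ) \ ball (r + Δ) ((-1, 0) : ℤ × ℤ) ∧
      (Spat r Δ ((0, 0) : ℤ × ℤ) ((-1, 0) : ℤ × ℤ)).Nonempty ∧
      ∃ C : Set (ℤ × ℤ), IsIdCode r Δ C := by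
  refine ⟨⟨?_, fun hmem => ?_⟩, Spat_nonempty hr h (by simp), Set.univ, fun u => ?_,
    fun u v huv => ?_⟩
  · simpa [ball] using (corner_bounds hr).2.2.1
  · have hout := (corner_bounds hr).2.2.2
    simp only [ball, Set.mem_ofPred_eq] at hmem
    push_cast at hmem
    linarith
  · exact ⟨u, by simp [ball, sq_nonneg], trivial⟩
  · simpa using Spat_nonempty hr h huv
end

section
/- Let r > 0 and Δ ≥ 0 be reals such that S_{r,Δ}((0,0),(−1,0)) is nonempty, and let x₀ = x₀(r,Δ) be the smallest nonnegative first coordinate of an element of S_{r,Δ}((0,0),(−1,0)). Let u and v be two distinct vertices of ℤ² lying on the same vertical or horizontal line (i.e., having the same first coordinate or the same second coordinate). If the Euclidean distance d(u,v) ≤ 4·x₀ + 1, then there exist two vertices u' and v' of ℤ² at Euclidean distance 1 such that S_{r,Δ}(u',v') ⊆ S_{r,Δ}(u,v). -/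
open Filter

theorem Spat_comm (r Δ : ℝ) (u v : ℤ × ℤ) : Spat r Δ u v = Spat r Δ v u :=
  Set.union_comm _ _

theorem mem_ball_swap {r : ℝ} {u p : ℤ × ℤ} : p.swap ∈ ball r u.swap ↔ p ∈ ball r u := by
  simp [ball, add_comm]

theorem mem_Spat_swap {r Δ : ℝ} {u v p : ℤ × ℤ} :
    p.swap ∈ Spat r Δ u.swap v.swap ↔ p ∈ Spat r Δ u v := by
  simp only [Spat, Set.mem_union, Set.mem_sdiff, mem_ball_swap]

theorem Spat_swap_subset {r Δ : ℝ} {u v u' v' : ℤ × ℤ} (h : Spat r Δ u' v' ⊆ Spat r Δ u v) :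
    Spat r Δ u'.swap v'.swap ⊆ Spat r Δ u.swap v.swap := by
  intro p hp
  rw [← Prod.swap_swap p, mem_Spat_swap] at hp ⊢
  exact h hp

/-- Points of `B_r(0,0)` outside `B_{r+Δ}(-1,0)` lie weakly to the right of any lower bound for the
nonnegative first coordinates of `S_{r,Δ}((0,0),(-1,0))`. -/
theorem le_of_mem_ball_of_notMem {r Δ : ℝ} (hr : 0 < r) (hΔ : 0 ≤ Δ) {x₀ : ℤ}
    (hmin : ∀ p ∈ Spat r Δ ((0, 0) : ℤ × ℤ) ((-1, 0) : ℤ × ℤ), 0 ≤ p.1 → x₀ ≤ p.1)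
    {x y : ℤ} (h₁ : (x : ℝ) ^ 2 + (y : ℝ) ^ 2 ≤ r ^ 2)
    (h₂ : (r + Δ) ^ 2 < ((x : ℝ) + 1) ^ 2 + (y : ℝ) ^ 2) : x₀ ≤ x := by
  have hx : 0 ≤ x := by
    have h : (-1 : ℝ) < 2 * x := by nlinarith [mul_nonneg hr.le hΔ]
    have h' : (-1 : ℤ) < 2 * x := by exact_mod_cast h
    omega
  refine hmin (x, y) (Or.inl ⟨?_, ?_⟩) hx
  · simpa [ball] using h₁
  · simpa [ball] using h₂

theorem Spat_adjacent_subset_horizontal {r Δ : ℝ} (hr : 0 < r) (hΔ : 0 ≤ Δ) {x₀ : ℤ}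
    (hmin : ∀ p ∈ Spat r Δ ((0, 0) : ℤ × ℤ) ((-1, 0) : ℤ × ℤ), 0 ≤ p.1 → x₀ ≤ p.1)
    (a b : ℤ) {j k : ℤ} (hj : 0 ≤ j) (hk : 0 ≤ k) (hj' : j ≤ 2 * x₀) (hk' : k ≤ 2 * x₀) :
    Spat r Δ (a, b) (a - 1, b) ⊆ Spat r Δ (a + k, b) (a - 1 - j, b) := by
  rintro ⟨p, q⟩ hp
  have hjR : (0 : ℝ) ≤ j := by exact_mod_cast hj
  have hkR : (0 : ℝ) ≤ k := by exact_mod_cast hk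
  have hjR' : (j : ℝ) ≤ 2 * x₀ := by exact_mod_cast hj'
  have hkR' : (k : ℝ) ≤ 2 * x₀ := by exact_mod_cast hk'
  simp only [Spat, ball, Set.mem_union, Set.mem_sdiff, Set.mem_ofPred_eq, not_le] at hp ⊢
  push_cast at hp ⊢
  rcases hp with ⟨h₁, h₂⟩ | ⟨h₁, h₂⟩
  · left
    have hx : x₀ ≤ p - a := le_of_mem_ball_of_notMem hr hΔ hmin (y := q - b)
      (by push_cast; linarith) (by push_cast; linarith)
    have hxR : (x₀ : ℝ) ≤ p - a := by exact_mod_cast hx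
    constructor <;> nlinarith
  · right
    have hx : x₀ ≤ a - 1 - p := le_of_mem_ball_of_notMem hr hΔ hmin (y := q - b)
      (by push_cast; linarith) (by push_cast; linarith)
    have hxR : (x₀ : ℝ) ≤ a - 1 - p := by exact_mod_cast hx
    constructor <;> nlinarith

theorem exists_adjacent_Spat_subset_horizontal {r Δ : ℝ} (hr : 0 < r) (hΔ : 0 ≤ Δ) {x₀ : ℤ}
    (hmin : ∀ p ∈ Spat r Δ ((0, 0) : ℤ × ℤ) ((-1, 0) : ℤ × ℤ), 0 ≤ p.1 → x₀ ≤ p.1)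
    {a c : ℤ} (b : ℤ) (hac : a ≠ c) (hd : |a - c| ≤ 4 * x₀ + 1) :
    ∃ u' v' : ℤ × ℤ, (u'.1 - v'.1) ^ 2 + (u'.2 - v'.2) ^ 2 = 1 ∧
      Spat r Δ u' v' ⊆ Spat r Δ (a, b) (c, b) := by
  wlog hlt : c < a generalizing a c
  · rw [Spat_comm r Δ (a, b)]
    exact this hac.symm (by rwa [abs_sub_comm]) (by omega)
  rw [abs_of_pos (by omega)] at hd
  set k := (a - c) / 2 with hk_def
  refine ⟨(a - k, b), (a - k - 1, b), by ring, ?_⟩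
  have h := Spat_adjacent_subset_horizontal hr hΔ hmin (a - k) b (j := a - k - 1 - c) (k := k)
    (by omega) (by omega) (by omega) (by omega)
  rwa [sub_add_cancel, sub_sub_cancel] at h

theorem stmt2 (r Δ : ℝ) (hr : 0 < r) (hΔ : 0 ≤ Δ)
    (hne : (Spat r Δ ((0, 0) : ℤ × ℤ) ((-1, 0) : ℤ × ℤ)).Nonempty)
    (x₀ : ℤ) (hx₀0 : 0 ≤ x₀)
    (hx₀mem : ∃ p ∈ Spat r Δ ((0, 0) : ℤ × ℤ) ((-1, 0) : ℤ × ℤ), p.1 = x₀)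
    (hx₀min : ∀ p ∈ Spat r Δ ((0, 0) : ℤ × ℤ) ((-1, 0) : ℤ × ℤ), 0 ≤ p.1 → x₀ ≤ p.1)
    (u v : ℤ × ℤ) (huv : u ≠ v) (hline : u.1 = v.1 ∨ u.2 = v.2)
    (hd : Real.sqrt (((u.1 - v.1 : ℤ) : ℝ) ^ 2 + ((u.2 - v.2 : ℤ) : ℝ) ^ 2) ≤
      4 * (x₀ : ℝ) + 1) :
    ∃ u' v' : ℤ × ℤ, (u'.1 - v'.1) ^ 2 + (u'.2 - v'.2) ^ 2 = 1 ∧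
      Spat r Δ u' v' ⊆ Spat r Δ u v := by
  rcases u with ⟨u₁, u₂⟩
  rcases v with ⟨v₁, v₂⟩
  rcases hline with h | h
  · obtain rfl : u₁ = v₁ := h
    have hd' : |u₂ - v₂| ≤ 4 * x₀ + 1 := by
      simp only [sub_self, Int.cast_zero, ne_eq, OfNat.ofNat_ne_zero, not_false_eq_true, zero_pow,
        zero_add, Real.sqrt_sq_eq_abs] at hd
      exact_mod_cast hd
    obtain ⟨u', v', h₁, h₂⟩ := exists_adjacent_Spat_subset_horizontal hr hΔ hx₀min u₁
      (fun h => huv (by rw [h])) hd'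
    exact ⟨u'.swap, v'.swap, by rw [← h₁]; exact add_comm _ _,
      by simpa only [Prod.swap_prod_mk] using Spat_swap_subset h₂⟩
  · obtain rfl : u₂ = v₂ := h
    have hd' : |u₁ - v₁| ≤ 4 * x₀ + 1 := by
      simp only [sub_self, Int.cast_zero, ne_eq, OfNat.ofNat_ne_zero, not_false_eq_true, zero_pow,
        add_zero, Real.sqrt_sq_eq_abs] at hd
      exact_mod_cast hd
    exact exists_adjacent_Spat_subset_horizontal hr hΔ hx₀min u₂ (fun h => huv (by rw [h])) hd'
end

section
/- Let r > 0 and Δ ≥ 0 be reals and let C ⊆ ℤ² be an (r,Δ)-identifying code. Then D(C) ≥ 1 / |S_{r,Δ}((0,0),(−1,0))|, where |S_{r,Δ}((0,0),(−1,0))| denotes the (finite, nonzero) cardinality of S_{r,Δ}((0,0),(−1,0)). -/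
open Filter

theorem Qset_eq_coe_Icc_product (n : ℕ) :
    Qset n = ↑(Finset.Icc (-(n : ℤ)) n ×ˢ Finset.Icc (-(n : ℤ)) n) := by
  ext p
  simp only [Qset, Set.mem_ofPred_eq, abs_le, Finset.mem_coe, Finset.mem_product, Finset.mem_Icc]

theorem Qset_finite (n : ℕ) : (Qset n).Finite := by
  rw [Qset_eq_coe_Icc_product]
  exact Finset.finite_toSet _

theorem card_Qset (n : ℕ) : Nat.card ↥(Qset n) = (2 * n + 1) ^ 2 := by
  have h : ((n : ℤ) + 1 + n).toNat = 2 * n + 1 := by omega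
  rw [Qset_eq_coe_Icc_product, Nat.card_coe_set_eq, Set.ncard_coe_finset]
  simp [h, sq]

theorem card_inter_Qset_le (C : Set (ℤ × ℤ)) (n : ℕ) :
    Nat.card ↥(C ∩ Qset n) ≤ (2 * n + 1) ^ 2 := by
  rw [← card_Qset]
  exact Nat.card_mono (Qset_finite n) Set.inter_subset_right

theorem add_mem_Qset {m n : ℕ} {u s : ℤ × ℤ} (hu : u ∈ Qset n) (hs : s ∈ Qset m) :
    u + s ∈ Qset (n + m) := by
  simp only [Qset, Set.mem_ofPred_eq, abs_le, Prod.fst_add, Prod.snd_add] at *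
  push_cast
  omega

theorem card_Qset_le_card_mul_of_forall_exists_add_mem {S C : Set (ℤ × ℤ)} {m : ℕ}
    (hS : S ⊆ Qset m) (h : ∀ u, ∃ s ∈ S, u + s ∈ C) (n : ℕ) :
    (2 * n + 1) ^ 2 ≤ Nat.card ↥S * Nat.card ↥(C ∩ Qset (n + m)) := by
  choose s hs hsC using h
  have : Finite ↥S := (Qset_finite m).subset hS
  have : Finite ↥(C ∩ Qset (n + m)) := (Qset_finite _).subset Set.inter_subset_right
  rw [← card_Qset, ← Nat.card_prod]
  refine Nat.card_le_card_of_injective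
    (fun u : Qset n => ((⟨s u, hs u⟩, ⟨u + s u, hsC u, add_mem_Qset u.2 (hS (hs u))⟩) :
      ↥S × ↥(C ∩ Qset (n + m)))) ?_
  intro u v huv
  have hs_eq : s u = s v := congrArg (fun q => (q.1 : ℤ × ℤ)) huv
  have hsum : (u : ℤ × ℤ) + s u = v + s v := congrArg (fun q => (q.2 : ℤ × ℤ)) huv
  rw [hs_eq] at hsum
  exact Subtype.ext (add_right_cancel hsum)

theorem tendsto_shifted_square_ratio (m k : ℕ) :
    Tendsto (fun n : ℕ => (1 - 2 * (m : ℝ) / (2 * (n : ℝ) + 1)) ^ 2 / (k : ℝ)) atTop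
      (nhds (1 / (k : ℝ))) := by
  have h : Tendsto (fun n : ℕ => 2 * (n : ℝ) + 1) atTop atTop :=
    tendsto_atTop_add_const_right _ _
      (tendsto_natCast_atTop_atTop.const_mul_atTop (by norm_num))
  simpa using (((h.const_div_atTop (2 * (m : ℝ))).const_sub 1).pow 2).div_const (k : ℝ)

theorem one_div_card_le_density {S C : Set (ℤ × ℤ)} {m : ℕ}
    (hS : S ⊆ Qset m) (h : ∀ u, ∃ s ∈ S, u + s ∈ C) :
    1 / (Nat.card ↥S : ℝ) ≤ density C := by
  have : Finite ↥S := (Qset_finite m).subset hS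
  have hpos : 0 < Nat.card ↥S := by
    obtain ⟨s, hs, -⟩ := h 0
    exact Nat.card_pos_iff.2 ⟨⟨s, hs⟩, this⟩
  have hlim := tendsto_shifted_square_ratio m (Nat.card ↥S)
  rw [← hlim.limsup_eq]
  refine limsup_le_limsup ?_ hlim.isCoboundedUnder_le ?_
  · filter_upwards [eventually_ge_atTop m] with n hn
    obtain ⟨j, rfl⟩ := Nat.exists_eq_add_of_le' hn
    have key := card_Qset_le_card_mul_of_forall_exists_add_mem hS h j
    have key' : (2 * (j : ℝ) + 1) ^ 2 ≤
        (Nat.card ↥S : ℝ) * (Nat.card ↥(C ∩ Qset (j + m)) : ℝ) := by exact_mod_cast key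
    have hk : (0 : ℝ) < Nat.card ↥S := by exact_mod_cast hpos
    have hden : (0 : ℝ) < 2 * ((j + m : ℕ) : ℝ) + 1 := by positivity
    have hratio : 1 - 2 * (m : ℝ) / (2 * ((j + m : ℕ) : ℝ) + 1) =
        (2 * (j : ℝ) + 1) / (2 * ((j + m : ℕ) : ℝ) + 1) := by
      field_simp
      push_cast
      ring
    rw [hratio, div_pow, div_right_comm]
    gcongr
    rwa [div_le_iff₀' hk]
  · refine isBoundedUnder_of ⟨1, fun n => div_le_one_of_le₀ ?_ (by positivity)⟩
    exact_mod_cast card_inter_Qset_le C n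

theorem ball_subset_Qset {r : ℝ} (hr : 0 ≤ r) {u : ℤ × ℤ} {k m : ℕ} (hu : u ∈ Qset k)
    (hm : r ≤ m) : ball r u ⊆ Qset (k + m) := by
  intro v hv
  simp only [ball, Set.mem_ofPred_eq] at hv
  have hx : |((v.1 - u.1 : ℤ) : ℝ)| ≤ m :=
    (abs_le_of_sq_le_sq (by nlinarith [sq_nonneg ((v.2 - u.2 : ℤ) : ℝ)]) hr).trans hm
  have hy : |((v.2 - u.2 : ℤ) : ℝ)| ≤ m :=
    (abs_le_of_sq_le_sq (by nlinarith [sq_nonneg ((v.1 - u.1 : ℤ) : ℝ)]) hr).trans hm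
  have hvu : v - u ∈ Qset m := ⟨by exact_mod_cast hx, by exact_mod_cast hy⟩
  simpa using add_mem_Qset hu hvu

theorem translate_mem_ball_translate_iff {r : ℝ} {u v w : ℤ × ℤ} :
    w + v ∈ ball r (w + u) ↔ v ∈ ball r u := by
  simp [ball]

theorem translate_mem_Spat_translate_iff {r Δ : ℝ} {u v w p : ℤ × ℤ} :
    w + p ∈ Spat r Δ (w + u) (w + v) ↔ p ∈ Spat r Δ u v := by
  simp [Spat, translate_mem_ball_translate_iff]

theorem stmt3 (r Δ : ℝ) (hr : 0 < r) (hΔ : 0 ≤ Δ)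
    (C : Set (ℤ × ℤ)) (hC : IsIdCode r Δ C) :
    density C ≥ 1 / (Nat.card ↥(Spat r Δ ((0, 0) : ℤ × ℤ) ((-1, 0) : ℤ × ℤ)) : ℝ) := by
  obtain ⟨m, hm⟩ := exists_nat_ge r
  have hS : Spat r Δ (0, 0) (-1, 0) ⊆ Qset (1 + m) := by
    rintro p (hp | hp)
    · exact ball_subset_Qset hr.le (by simp [Qset]) hm hp.1
    · exact ball_subset_Qset hr.le (by simp [Qset]) hm hp.1
  refine one_div_card_le_density hS fun u => ?_
  obtain ⟨c, hc, hcC⟩ := hC.2 (u + (0, 0)) (u + (-1, 0)) (by simp)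
  refine ⟨c - u, translate_mem_Spat_translate_iff (w := u).1 ?_, ?_⟩ <;> simpa
end

section
/- Let r ≥ 1 and Δ ≥ 0 be reals and let k be a positive integer with k ≤ ⌊r⌋. Assume that for every integer x with ⌊r⌋ − k < x ≤ ⌊r⌋ there exists an integer y ≥ 0 such that (x,y) ∈ B_r((0,0)) ∖ B_{r+Δ}((−1,0)) (this is the condition that in the first quadrant the horizontal pattern S_{r,Δ}((0,0),(−1,0)) has a vertex in each of the k consecutive abscissas ending at ⌊r⌋; it holds when k = ⌊r⌋ − x₁(r,Δ) for the threshold x₁ of the paper). Then the code C = L^v_k ∪ L^h_k is an (r,Δ)-identifying code, and D(C) ≤ 2/k. -/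
open Filter

/-- Among `k` consecutive integers ending at `F` one becomes divisible by `k` after adding `m`. -/
theorem exists_mem_window_dvd_add (F m : ℤ) {k : ℕ} (hk : 0 < k) :
    ∃ x : ℤ, F - k < x ∧ x ≤ F ∧ (k : ℤ) ∣ m + x := by
  have hk' : (0 : ℤ) < k := by exact_mod_cast hk
  have h₁ := Int.emod_nonneg (m + F) hk'.ne'
  have h₂ := Int.emod_lt_of_pos (m + F) hk'
  refine ⟨F - (m + F) % k, by linarith, by linarith, ?_⟩
  have h₃ := Int.dvd_self_sub_emod (x := m + F) (m := (k : ℤ))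
  rwa [add_sub_assoc] at h₃

/-- Whenever `s < m`, the difference of the balls around `(m, n)` and `(s, t)` meets a line
`x = p` with `k ∣ p`. -/
theorem exists_dvd_separating {r Δ : ℝ} {k : ℕ} (hk : 0 < k) (hkr : (k : ℤ) ≤ ⌊r⌋)
    (h : ∀ x : ℤ, ⌊r⌋ - (k : ℤ) < x → x ≤ ⌊r⌋ →
      ∃ y : ℤ, 0 ≤ y ∧
        ((x, y) : ℤ × ℤ) ∈ ball r ((0, 0) : ℤ × ℤ) \ ball (r + Δ) ((-1, 0) : ℤ × ℤ))
    {m s : ℤ} (n t : ℤ) (hsm : s < m) :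
    ∃ p q : ℤ, (k : ℤ) ∣ p ∧
      ((p - m : ℤ) : ℝ) ^ 2 + ((q - n : ℤ) : ℝ) ^ 2 ≤ r ^ 2 ∧
      (r + Δ) ^ 2 < ((p - s : ℤ) : ℝ) ^ 2 + ((q - t : ℤ) : ℝ) ^ 2 := by
  obtain ⟨x, hx₁, hx₂, hdvd⟩ := exists_mem_window_dvd_add ⌊r⌋ m hk
  obtain ⟨y, hy, hin, hout⟩ := h x hx₁ hx₂
  simp only [ball, Set.mem_ofPred_eq, not_le] at hin hout
  have hx : 0 ≤ x := by linarith
  have hfst : (x - -1) ^ 2 ≤ (m + x - s) ^ 2 :=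
    pow_le_pow_left₀ (by linarith) (by linarith) 2
  have of_sign (ε : ℤ) (hε : ε ^ 2 = 1) (hsign : 0 ≤ ε * (n - t)) :
      ∃ p q : ℤ, (k : ℤ) ∣ p ∧
        ((p - m : ℤ) : ℝ) ^ 2 + ((q - n : ℤ) : ℝ) ^ 2 ≤ r ^ 2 ∧
        (r + Δ) ^ 2 < ((p - s : ℤ) : ℝ) ^ 2 + ((q - t : ℤ) : ℝ) ^ 2 := by
    refine ⟨m + x, n + ε * y, hdvd, ?_, hout.trans_le ?_⟩
    · have hball : (m + x - m) ^ 2 + (n + ε * y - n) ^ 2 = (x - 0) ^ 2 + (y - 0) ^ 2 := by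
        linear_combination y ^ 2 * hε
      calc _ = ((x - 0 : ℤ) : ℝ) ^ 2 + ((y - 0 : ℤ) : ℝ) ^ 2 := by exact_mod_cast hball
        _ ≤ r ^ 2 := hin
    · have hsnd : (y - 0) ^ 2 ≤ (n + ε * y - t) ^ 2 := by
        have hexp : (n + ε * y - t) ^ 2 = (n - t) ^ 2 + 2 * (y * (ε * (n - t))) + y ^ 2 := by
          linear_combination y ^ 2 * hε
        nlinarith [mul_nonneg hy hsign, sq_nonneg (n - t)]
      exact_mod_cast add_le_add hfst hsnd
  rcases le_total t n with htn | htn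
  · exact of_sign 1 (by norm_num) (by linarith)
  · exact of_sign (-1) (by norm_num) (by linarith)

theorem isIdCode_Lv_union_Lh {r Δ : ℝ} {k : ℕ} (hk : 0 < k) (hkr : (k : ℤ) ≤ ⌊r⌋)
    (h : ∀ x : ℤ, ⌊r⌋ - (k : ℤ) < x → x ≤ ⌊r⌋ →
      ∃ y : ℤ, 0 ≤ y ∧
        ((x, y) : ℤ × ℤ) ∈ ball r ((0, 0) : ℤ × ℤ) \ ball (r + Δ) ((-1, 0) : ℤ × ℤ)) :
    IsIdCode r Δ (Lv k ∪ Lh k) := by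
  constructor
  · rintro ⟨m, n⟩
    obtain ⟨p, q, hp, hball, -⟩ := exists_dvd_separating hk hkr h n n (sub_one_lt m)
    exact ⟨(p, q), hball, Or.inl hp⟩
  · have of_fst_lt (u v : ℤ × ℤ) (huv : v.1 < u.1) :
        (Spat r Δ u v ∩ (Lv k ∪ Lh k)).Nonempty := by
      obtain ⟨p, q, hp, hin, hout⟩ := exists_dvd_separating hk hkr h u.2 v.2 huv
      exact ⟨(p, q), Or.inl ⟨hin, not_le.2 hout⟩, Or.inl hp⟩
    have of_snd_lt (u v : ℤ × ℤ) (huv : v.2 < u.2) :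
        (Spat r Δ u v ∩ (Lv k ∪ Lh k)).Nonempty := by
      obtain ⟨p, q, hp, hin, hout⟩ := exists_dvd_separating hk hkr h u.1 v.1 huv
      rw [add_comm] at hin
      rw [add_comm (_ ^ 2)] at hout
      exact ⟨(q, p), Or.inl ⟨hin, not_le.2 hout⟩, Or.inr hp⟩
    intro u v huv
    rcases lt_trichotomy u.1 v.1 with h₁ | h₁ | h₁
    · rw [Spat_comm]
      exact of_fst_lt v u h₁
    · rcases lt_trichotomy u.2 v.2 with h₂ | h₂ | h₂
      · rw [Spat_comm]
        exact of_snd_lt v u h₂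
      · exact absurd (Prod.ext h₁ h₂) huv
      · exact of_snd_lt u v h₂
    · exact of_fst_lt u v h₁

theorem card_filter_dvd_Icc_le (n : ℕ) {k : ℕ} (hk : 0 < k) :
    (((Finset.Icc (-n : ℤ) n).filter ((k : ℤ) ∣ ·)).card : ℝ) ≤ (2 * n + 1) / k + 1 := by
  have hk' : (0 : ℤ) < k := by exact_mod_cast hk
  have hIcc : Finset.Icc (-n : ℤ) n = Finset.Ioc (-n - 1 : ℤ) n := by
    ext x
    simp only [Finset.mem_Icc, Finset.mem_Ioc]
    omega
  have hcard := Int.Ioc_filter_dvd_card (-n - 1) n hk'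
  have hcard' : (((Finset.Icc (-n : ℤ) n).filter ((k : ℤ) ∣ ·)).card : ℚ) ≤
      (2 * n + 1) / k + 1 := by
    rw [hIcc, ← Int.cast_natCast, hcard]
    push_cast
    refine max_le ?_ (by positivity)
    have h₁ := Int.floor_le ((n : ℚ) / k)
    have h₂ := Int.lt_floor_add_one ((-n - 1 : ℚ) / k)
    have h₃ : (2 * n + 1 : ℚ) / k = n / k - (-n - 1) / k := by ring
    linarith
  have hcast := (Rat.cast_le (K := ℝ)).2 hcard'
  push_cast at hcast
  exact hcast

theorem card_Lv_union_Lh_inter_Qset_le (n : ℕ) {k : ℕ} (hk : 0 < k) :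
    (Nat.card ↥((Lv k ∪ Lh k) ∩ Qset n) : ℝ) ≤
      2 * ((2 * n + 1) * ((2 * n + 1) / k + 1)) := by
  classical
  set I := Finset.Icc (-n : ℤ) n
  set A := I.filter ((k : ℤ) ∣ ·)
  have hsub : (Lv k ∪ Lh k) ∩ Qset n ⊆ ((A ×ˢ I ∪ I ×ˢ A : Finset (ℤ × ℤ)) : Set (ℤ × ℤ)) := by
    rintro ⟨x, y⟩ ⟨hC, hx, hy⟩
    have hxI : x ∈ I := Finset.mem_Icc.2 (abs_le.1 hx)
    have hyI : y ∈ I := Finset.mem_Icc.2 (abs_le.1 hy)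
    rw [Finset.mem_coe, Finset.mem_union, Finset.mem_product, Finset.mem_product]
    exact hC.imp (fun hd => ⟨Finset.mem_filter.2 ⟨hxI, hd⟩, hyI⟩)
      (fun hd => ⟨hxI, Finset.mem_filter.2 ⟨hyI, hd⟩⟩)
  have hI : I.card = 2 * n + 1 := by
    rw [Int.card_Icc]
    omega
  have hcard : Nat.card ↥((Lv k ∪ Lh k) ∩ Qset n) ≤ 2 * ((2 * n + 1) * A.card) := by
    calc _ ≤ (A ×ˢ I ∪ I ×ˢ A).card := by
          rw [Nat.card_coe_set_eq, ← Set.ncard_coe_finset]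
          exact Set.ncard_le_ncard hsub (Finset.finite_toSet _)
      _ ≤ (A ×ˢ I).card + (I ×ˢ A).card := Finset.card_union_le _ _
      _ = 2 * ((2 * n + 1) * A.card) := by
          rw [Finset.card_product, Finset.card_product, hI]
          ring
  calc (Nat.card ↥((Lv k ∪ Lh k) ∩ Qset n) : ℝ) ≤ 2 * ((2 * n + 1) * A.card) := by
        exact_mod_cast hcard
    _ ≤ _ := by
        gcongr
        exact card_filter_dvd_Icc_le n hk

theorem density_Lv_union_Lh_le {k : ℕ} (hk : 0 < k) :
    density (Lv k ∪ Lh k) ≤ 2 / (k : ℝ) := by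
  have hlim : Tendsto (fun n : ℕ => 2 / (k : ℝ) + 2 / (2 * (n : ℝ) + 1)) atTop
      (nhds (2 / (k : ℝ))) := by
    have hden : Tendsto (fun n : ℕ => 2 * (n : ℝ) + 1) atTop atTop :=
      tendsto_atTop_add_const_right _ _
        (tendsto_natCast_atTop_atTop.const_mul_atTop (by norm_num))
    simpa using (hden.const_div_atTop 2).const_add (2 / (k : ℝ))
  rw [density, ← hlim.limsup_eq]
  refine limsup_le_limsup (Eventually.of_forall fun n => ?_) ?_ hlim.isBoundedUnder_le
  · rw [div_le_iff₀ (by positivity)]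
    refine (card_Lv_union_Lh_inter_Qset_le n hk).trans_eq ?_
    have hk' : (k : ℝ) ≠ 0 := by positivity
    field_simp
  · exact (isBoundedUnder_of ⟨0, fun n => by positivity⟩ :
      IsBoundedUnder (· ≥ ·) atTop _).isCoboundedUnder_le

theorem stmt4 (r Δ : ℝ) (hr : 1 ≤ r) (hΔ : 0 ≤ Δ) (k : ℕ) (hk : 0 < k)
    (hkr : (k : ℤ) ≤ ⌊r⌋)
    (h : ∀ x : ℤ, ⌊r⌋ - (k : ℤ) < x → x ≤ ⌊r⌋ →
      ∃ y : ℤ, 0 ≤ y ∧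
        ((x, y) : ℤ × ℤ) ∈ ball r ((0, 0) : ℤ × ℤ) \ ball (r + Δ) ((-1, 0) : ℤ × ℤ)) :
    IsIdCode r Δ (Lv k ∪ Lh k) ∧ density (Lv k ∪ Lh k) ≤ 2 / (k : ℝ) := by
  exact ⟨isIdCode_Lv_union_Lh hk hkr h, density_Lv_union_Lh_le hk⟩
end

section
/- Let r > 0 be a real number and u ∈ ℤ². Then diag(B_r(u)) = 4⌊r/√2⌋ + 2δ + 1, where δ = 1 if ⌊r/√2⌋² + (⌊r/√2⌋ + 1)² ≤ r² and δ = 0 otherwise. -/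
open Filter

/-- A set whose diagonals `y - x` are exactly those in the integer interval `[a, b]` has
diagonal number `b - a + 1`. -/
theorem diagNum_eq_of_image_eq_Icc {U : Set (ℤ × ℤ)} {a b : ℤ} (hab : a ≤ b)
    (hU : (fun p : ℤ × ℤ => p.2 - p.1) '' U = Set.Icc a b) :
    (diagNum U : ℤ) = b - a + 1 := by
  have hmem : ∀ k : ℕ, IntersectsDiagMod U k ↔
      ∀ i : ℤ, ∃ d ∈ Set.Icc a b, Int.ModEq (k : ℤ) d i := by
    intro k
    simp only [← hU, Set.exists_mem_image, IntersectsDiagMod]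
  obtain ⟨n, hn⟩ : ∃ n : ℕ, (n : ℤ) = b - a + 1 := ⟨(b - a + 1).toNat, by omega⟩
  have hgreatest : IsGreatest {k : ℕ | 0 < k ∧ IntersectsDiagMod U k} n := by
    refine ⟨⟨by omega, (hmem n).2 fun i => ?_⟩, ?_⟩
    · have h0 := Int.emod_nonneg (i - a) (b := (n : ℤ)) (by omega)
      have h1 := Int.emod_lt_of_pos (i - a) (b := (n : ℤ)) (by omega)
      refine ⟨a + (i - a) % n, ⟨by omega, by omega⟩, ?_⟩
      simpa using (Int.mod_modEq (i - a) n).add_left a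
    · rintro k ⟨-, hk⟩
      obtain ⟨d, ⟨had, hdb⟩, hd⟩ := (hmem k).1 hk (b + 1)
      have := Int.le_of_dvd (by omega) hd.dvd
      omega
  rw [diagNum, hgreatest.csSup_eq, hn]

/-- The diagonals met by a lattice disc, in terms of the integer `m` with
`√2 m ≤ r < √2 (m + 1)`. -/
theorem image_ball_eq_Icc {r : ℝ} {m δ : ℤ} (u : ℤ × ℤ) (hm : 0 ≤ m)
    (hle : 2 * (m : ℝ) ^ 2 ≤ r ^ 2) (hlt : r ^ 2 < 2 * ((m : ℝ) + 1) ^ 2)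
    (hδ : δ = if (m : ℝ) ^ 2 + ((m : ℝ) + 1) ^ 2 ≤ r ^ 2 then 1 else 0) :
    (fun p : ℤ × ℤ => p.2 - p.1) '' ball r u =
      Set.Icc (u.2 - u.1 - (2 * m + δ)) (u.2 - u.1 + (2 * m + δ)) := by
  have hδ01 : δ = 0 ∨ δ = 1 := by
    rw [hδ]
    split_ifs <;> simp
  have hδ_le : δ = 1 → (m : ℝ) ^ 2 + ((m : ℝ) + 1) ^ 2 ≤ r ^ 2 := by
    intro h
    by_contra hc
    simp [hc] at hδ
    omega
  ext d
  constructor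
  · rintro ⟨⟨x, y⟩, hp, rfl⟩
    obtain ⟨s, rfl⟩ : ∃ s, x = u.1 + s := ⟨x - u.1, by ring⟩
    obtain ⟨t, rfl⟩ : ∃ t, y = u.2 + t := ⟨y - u.2, by ring⟩
    simp only [ball, Set.mem_ofPred_eq, add_sub_cancel_left] at hp
    have hst : s ^ 2 + t ^ 2 < 2 * (m + 1) ^ 2 := by
      exact_mod_cast hp.trans_lt hlt
    have habs : |t - s| < 2 * (m + 1) := by
      apply abs_lt_of_sq_lt_sq _ (by omega)
      nlinarith [sq_nonneg (s + t)]
    have hodd : |t - s| = 2 * m + 1 → δ = 1 := by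
      intro h
      have hsq : (t - s) ^ 2 = (2 * m + 1) ^ 2 := by rw [← sq_abs, h]
      have hne : s + t ≠ 0 := by
        intro h0
        rcases abs_cases (t - s) with hc | hc <;> omega
      have hpos : 0 < (s + t) ^ 2 := by positivity
      have hint : m ^ 2 + (m + 1) ^ 2 ≤ s ^ 2 + t ^ 2 := by nlinarith
      have hreal : (m : ℝ) ^ 2 + ((m : ℝ) + 1) ^ 2 ≤ (s : ℝ) ^ 2 + (t : ℝ) ^ 2 := by
        exact_mod_cast hint
      rw [hδ, if_pos (hreal.trans hp)]
    simp only [Set.mem_Icc]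
    rcases abs_cases (t - s) with hc | hc <;> omega
  · rintro ⟨h1, h2⟩
    suffices h : ∃ s t : ℤ, t - s = d - (u.2 - u.1) ∧ (s : ℝ) ^ 2 + (t : ℝ) ^ 2 ≤ r ^ 2 by
      obtain ⟨s, t, hst, h⟩ := h
      refine ⟨(u.1 + s, u.2 + t), ?_, ?_⟩
      · simpa [ball] using h
      · simp only
        omega
    obtain ⟨j, hj | hj⟩ := Int.even_or_odd' (d - (u.2 - u.1))
    · refine ⟨-j, j, by omega, le_trans ?_ hle⟩
      have : (-j) ^ 2 + j ^ 2 ≤ 2 * m ^ 2 := by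
        have := sq_le_sq' (a := j) (b := m) (by omega) (by omega)
        linarith [neg_sq j]
      exact_mod_cast this
    · refine ⟨-j, j + 1, by omega, ?_⟩
      by_cases hjm : -m ≤ j ∧ j + 1 ≤ m
      · refine le_trans ?_ hle
        have : (-j) ^ 2 + (j + 1) ^ 2 ≤ 2 * m ^ 2 := by
          have h3 := sq_le_sq' (a := j) (b := m) (by omega) (by omega)
          have h4 := sq_le_sq' (a := j + 1) (b := m) (by omega) (by omega)
          linarith [neg_sq j]
        exact_mod_cast this
      · refine le_trans (le_of_eq ?_) (hδ_le (by omega))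
        obtain rfl | rfl : j = m ∨ j = -m - 1 := by omega
        · push_cast
          ring
        · push_cast
          ring

theorem stmt5 (r : ℝ) (hr : 0 < r) (u : ℤ × ℤ) :
    (diagNum (ball r u) : ℤ) =
      4 * ⌊r / Real.sqrt 2⌋ +
        2 * (if (⌊r / Real.sqrt 2⌋ : ℝ) ^ 2 + ((⌊r / Real.sqrt 2⌋ : ℝ) + 1) ^ 2 ≤ r ^ 2
          then 1 else 0) + 1 := by
  have hsq : Real.sqrt 2 ^ 2 = 2 := Real.sq_sqrt (by norm_num)
  have hdiv : 2 * (r / Real.sqrt 2) ^ 2 = r ^ 2 := by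
    rw [div_pow, hsq]
    ring
  have hm : 0 ≤ ⌊r / Real.sqrt 2⌋ := Int.floor_nonneg.2 (by positivity)
  have hfloor := Int.floor_le (r / Real.sqrt 2)
  have hfloor' := Int.lt_floor_add_one (r / Real.sqrt 2)
  have hm' : (0 : ℝ) ≤ ⌊r / Real.sqrt 2⌋ := by exact_mod_cast hm
  have himage := image_ball_eq_Icc u hm
    (by rw [← hdiv]; gcongr) (by rw [← hdiv]; gcongr) rfl
  rw [diagNum_eq_of_image_eq_Icc (by split_ifs <;> omega) himage]
  ring
end

section
/- Let r > 0 and Δ ≥ 0 be reals and let s be a positive integer with s ≤ diag(B_r((0,0))). If S_{r,Δ}((0,0),(−1,0)) intersects all diagonal lines modulo s, then for every pair of distinct vertices u,v ∈ ℤ² that lie on the same horizontal or vertical line (i.e., have equal second coordinates or equal first coordinates), the set S_{r,Δ}(u,v) intersects all diagonal lines modulo s. -/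
open Filter

theorem mem_ball_iff_le_floor (r : ℝ) (u p : ℤ × ℤ) :
    p ∈ ball r u ↔ (p.1 - u.1) ^ 2 + (p.2 - u.2) ^ 2 ≤ ⌊r ^ 2⌋ := by
  rw [Int.le_floor, ball, Set.mem_ofPred_eq]
  push_cast
  rfl

theorem mem_Spat_iff (r Δ : ℝ) (u v p : ℤ × ℤ) :
    p ∈ Spat r Δ u v ↔
      ((p.1 - u.1) ^ 2 + (p.2 - u.2) ^ 2 ≤ ⌊r ^ 2⌋ ∧
          ⌊(r + Δ) ^ 2⌋ < (p.1 - v.1) ^ 2 + (p.2 - v.2) ^ 2) ∨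
        ((p.1 - v.1) ^ 2 + (p.2 - v.2) ^ 2 ≤ ⌊r ^ 2⌋ ∧
          ⌊(r + Δ) ^ 2⌋ < (p.1 - u.1) ^ 2 + (p.2 - u.2) ^ 2) := by
  simp only [Spat, Set.mem_union, Set.mem_sdiff, mem_ball_iff_le_floor, not_le]

/-- The diagonals meeting a disc centred at the origin form an interval symmetric about `0`. -/
theorem exists_mem_disc_of_abs_le (n b : ℤ) (x y : ℤ) (h : x ^ 2 + y ^ 2 ≤ n)
    (hb : |b| ≤ |y - x|) : ∃ x' y' : ℤ, x' ^ 2 + y' ^ 2 ≤ n ∧ y' - x' = b := by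
  have step : ∀ (k : ℕ) (x y : ℤ), x ^ 2 + y ^ 2 ≤ n → y - x = b + k → 0 ≤ b →
      ∃ x' y' : ℤ, x' ^ 2 + y' ^ 2 ≤ n ∧ y' - x' = b := by
    intro k
    induction k with
    | zero => exact fun x y h e _ => ⟨x, y, h, by simpa using e⟩
    | succ k ih =>
      intro x y h e hb
      push_cast at e
      rcases lt_or_ge x 0 with hx | hx
      · exact ih (x + 1) y (by nlinarith) (by linarith) hb
      · exact ih x (y - 1) (by nlinarith) (by linarith) hb
  have step' : ∀ (k : ℕ) (x y : ℤ), x ^ 2 + y ^ 2 ≤ n → y - x = b - k → b ≤ 0 →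
      ∃ x' y' : ℤ, x' ^ 2 + y' ^ 2 ≤ n ∧ y' - x' = b := by
    intro k
    induction k with
    | zero => exact fun x y h e _ => ⟨x, y, h, by simpa using e⟩
    | succ k ih =>
      intro x y h e hb
      push_cast at e
      rcases lt_or_ge 0 x with hx | hx
      · exact ih (x - 1) y (by nlinarith) (by linarith) hb
      · exact ih x (y + 1) (by nlinarith) (by linarith) hb
  rcases le_total 0 b with h0 | h0 <;> rcases le_total 0 (y - x) with h1 | h1
  · rw [abs_of_nonneg h0, abs_of_nonneg h1] at hb
    exact step (y - x - b).toNat x y h (by omega) h0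
  · rw [abs_of_nonneg h0, abs_of_nonpos h1] at hb
    exact step (x - y - b).toNat y x (by linarith) (by omega) h0
  · rw [abs_of_nonpos h0, abs_of_nonneg h1] at hb
    exact step' (b - (x - y)).toNat y x (by linarith) (by omega) h0
  · rw [abs_of_nonpos h0, abs_of_nonpos h1] at hb
    exact step' (b - (y - x)).toNat x y h (by omega) h0

theorem IntersectsDiagMod.ball_mono {r : ℝ} {K s : ℕ} (hs : 0 < s) (hsK : s ≤ K)
    (h : IntersectsDiagMod (ball r (0, 0)) K) : IntersectsDiagMod (ball r (0, 0)) s := by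
  intro i
  obtain ⟨p, hp, hpK⟩ := h (K / 2 : ℕ)
  rw [mem_ball_iff_le_floor] at hp
  simp only [sub_zero] at hp
  have hfar : ((K / 2 : ℕ) : ℤ) ≤ |p.2 - p.1| := by
    obtain ⟨c, hc⟩ := hpK.dvd
    rcases lt_trichotomy c 0 with hc0 | rfl | hc0
    · have := le_abs_self (p.2 - p.1)
      have : (K : ℤ) * c ≤ K * (-1) := by gcongr; omega
      omega
    · have := le_abs_self (p.2 - p.1)
      omega
    · have := neg_abs_le (p.2 - p.1)
      have : (K : ℤ) * 1 ≤ K * c := by gcongr; omega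
      omega
  have hb1 := Int.le_bmod (x := i) hs
  have hb2 := Int.bmod_lt (x := i) hs
  have hb : |Int.bmod i s| ≤ |p.2 - p.1| := by
    refine le_trans ?_ hfar
    rw [abs_le]
    omega
  obtain ⟨x, y, hxy, e⟩ := exists_mem_disc_of_abs_le _ _ _ _ hp hb
  refine ⟨(x, y), ?_, ?_⟩
  · rw [mem_ball_iff_le_floor]
    simpa using hxy
  · rw [e]
    exact Int.bmod_emod

theorem intersectsDiagMod_ball_of_le_diagNum {r : ℝ} {s : ℕ} (hs : 0 < s)
    (h : s ≤ diagNum (ball r (0, 0))) : IntersectsDiagMod (ball r (0, 0)) s := by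
  have hpos : sSup {k : ℕ | 0 < k ∧ IntersectsDiagMod (ball r (0, 0)) k} ≠ 0 :=
    (hs.trans_le h).ne'
  have hmem := Nat.sSup_mem
    (Set.nonempty_iff_ne_empty.2 fun he => hpos (by rw [he]; exact csSup_empty))
    (by_contra fun hb => hpos (csSup_of_not_bddAbove hb |>.trans csSup_empty))
  exact hmem.2.ball_mono hs h

theorem IntersectsDiagMod.Spat_left_shift {r Δ : ℝ} (hr : 0 < r) (hΔ : 0 ≤ Δ) {s : ℕ}
    (hball : IntersectsDiagMod (ball r (0, 0)) s)
    (h : IntersectsDiagMod (Spat r Δ (0, 0) (-1, 0)) s) {d : ℤ} (hd : 1 ≤ d) :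
    IntersectsDiagMod (Spat r Δ (0, 0) (-d, 0)) s := by
  have hnm : ⌊r ^ 2⌋ ≤ ⌊(r + Δ) ^ 2⌋ := Int.floor_le_floor (by gcongr; linarith)
  simp only [IntersectsDiagMod, mem_Spat_iff, mem_ball_iff_le_floor, sub_zero, sub_neg_eq_add]
    at h hball ⊢
  generalize ⌊r ^ 2⌋ = n at *
  generalize ⌊(r + Δ) ^ 2⌋ = m at *
  intro i
  obtain ⟨⟨x, y⟩, ⟨hin, hout⟩ | ⟨hin, hout⟩, hi⟩ := h i <;> dsimp only at hin hout hi
  · have hx : 0 ≤ x := by nlinarith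
    exact ⟨(x, y), Or.inl ⟨hin, by dsimp only; nlinarith⟩, hi⟩
  obtain ⟨f, rfl⟩ : ∃ f, x = -f - 1 := ⟨-x - 1, by ring⟩
  have hf : 0 ≤ f := by nlinarith
  rcases le_or_gt d (2 * f + 1) with hdf | hdf
  · exact ⟨(-f - 1, y), Or.inr ⟨by dsimp only; nlinarith, hout⟩, hi⟩
  rcases lt_or_ge y 0 with hy | hy
  · refine ⟨(-y - 1, f), Or.inl ⟨by dsimp only; nlinarith, ?_⟩, ?_⟩
    · have : (-y + 2 * f + 1) ^ 2 ≤ (-y - 1 + d) ^ 2 :=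
        pow_le_pow_left₀ (by omega) (by omega) 2
      dsimp only
      nlinarith [mul_nonneg hf (neg_nonneg.2 hy.le)]
    · convert hi using 1
      ring
  rcases lt_or_ge (d - 2 * f - 2) (2 * y) with he | he
  · refine ⟨(-2 * f - 1 - y, -f), Or.inr ⟨?_, ?_⟩, ?_⟩
    · have : (-2 * f - 1 - y + d) ^ 2 ≤ y ^ 2 := by
        apply sq_le_sq' <;> omega
      dsimp only
      nlinarith
    · dsimp only
      nlinarith [mul_nonneg hf hy]
    · convert hi using 1
      ring
  · obtain ⟨⟨x, z⟩, hxz, hz⟩ := hball i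
    dsimp only at hxz
    refine ⟨(x, z), Or.inl ⟨hxz, ?_⟩, hz⟩
    have hm : m < (f + 1 + y) ^ 2 := by nlinarith [mul_nonneg hf hy]
    have hx : -(f + 1 + y) < x :=
      (abs_lt_of_sq_lt_sq (show x ^ 2 < (f + 1 + y) ^ 2 by nlinarith) (by omega) |> abs_lt.1).1
    have : (f + 1 + y) ^ 2 ≤ (x + d) ^ 2 := pow_le_pow_left₀ (by omega) (by omega) 2
    dsimp only
    nlinarith

theorem IntersectsDiagMod.Spat_translate {r Δ : ℝ} {s : ℕ} {u v : ℤ × ℤ}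
    (h : IntersectsDiagMod (Spat r Δ u v) s) (w : ℤ × ℤ) :
    IntersectsDiagMod (Spat r Δ (u + w) (v + w)) s := by
  intro i
  obtain ⟨p, hp, hi⟩ := h (i - (w.2 - w.1))
  refine ⟨p + w, ?_, ?_⟩
  · rw [mem_Spat_iff] at hp ⊢
    simpa using hp
  · convert hi.add_right (w.2 - w.1) using 1
    · simp only [Prod.fst_add, Prod.snd_add]
      ring
    · ring

theorem IntersectsDiagMod.Spat_swap {r Δ : ℝ} {s : ℕ} {u v : ℤ × ℤ}
    (h : IntersectsDiagMod (Spat r Δ u v) s) :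
    IntersectsDiagMod (Spat r Δ u.swap v.swap) s := by
  intro i
  obtain ⟨p, hp, hi⟩ := h (-i)
  refine ⟨p.swap, ?_, ?_⟩
  · rw [mem_Spat_iff] at hp ⊢
    simpa [add_comm] using hp
  · simpa using hi.neg

theorem IntersectsDiagMod.Spat_of_snd_eq {r Δ : ℝ} (hr : 0 < r) (hΔ : 0 ≤ Δ) {s : ℕ}
    (hball : IntersectsDiagMod (ball r (0, 0)) s)
    (h : IntersectsDiagMod (Spat r Δ (0, 0) (-1, 0)) s) {u v : ℤ × ℤ} (huv : u ≠ v)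
    (hline : u.2 = v.2) : IntersectsDiagMod (Spat r Δ u v) s := by
  wlog hlt : v.1 < u.1 generalizing u v
  · have hne : u.1 ≠ v.1 := fun e => huv (Prod.ext e hline)
    rw [Spat_comm]
    exact this huv.symm hline.symm (by omega)
  convert (hball.Spat_left_shift hr hΔ h (d := u.1 - v.1) (by omega)).Spat_translate u using 2
  · ext <;> simp
  · ext <;> simp [hline]

theorem stmt6 (r Δ : ℝ) (hr : 0 < r) (hΔ : 0 ≤ Δ) (s : ℕ) (hs : 0 < s)
    (hsd : s ≤ diagNum (ball r ((0, 0) : ℤ × ℤ)))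
    (h : IntersectsDiagMod (Spat r Δ ((0, 0) : ℤ × ℤ) ((-1, 0) : ℤ × ℤ)) s)
    (u v : ℤ × ℤ) (huv : u ≠ v) (hline : u.1 = v.1 ∨ u.2 = v.2) :
    IntersectsDiagMod (Spat r Δ u v) s := by
  have hball := intersectsDiagMod_ball_of_le_diagNum hs hsd
  rcases hline with hline | hline
  · have hsw : u.swap ≠ v.swap := Prod.swap_injective.ne huv
    simpa using (hball.Spat_of_snd_eq hr hΔ h hsw (by simpa using hline)).Spat_swap
  · exact hball.Spat_of_snd_eq hr hΔ h huv hline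
end

section
/- Let s be a fixed positive integer. There exists a real number r₀ such that for all real r ≥ r₀ and all real Δ with 0 ≤ Δ ≤ 1, the set S_{r,Δ}((0,0),(−1,−1)) intersects all diagonal lines and all anti-diagonal lines modulo s within the first quadrant; that is, for every i ∈ {0,…,s−1} there exist (x,y) ∈ S_{r,Δ}((0,0),(−1,−1)) with x ≥ 0, y ≥ 0 and y−x ≡ i (mod s), and (x',y') ∈ S_{r,Δ}((0,0),(−1,−1)) with x' ≥ 0, y' ≥ 0 and x'+y' ≡ i (mod s). -/
open Filter

theorem exists_int_residue_mem_Ioc (a : ℤ) {m : ℝ} (hm : 0 < m) (t : ℝ) :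
    ∃ k : ℤ, t - m < a + m * k ∧ a + m * k ≤ t := by
  refine ⟨⌊(t - a) / m⌋, ?_, ?_⟩
  · have h := Int.lt_floor_add_one ((t - a) / m)
    rw [div_lt_iff₀ hm] at h
    linarith
  · have h := Int.floor_le ((t - a) / m)
    rw [le_div_iff₀ hm] at h
    linarith

/-- If `u` lies just below `√2 r` and `d` just below `√(2r² - u²)`, then the point with
coordinate sum `u` and coordinate difference `d` lies in the disc of radius `r`, while its
translate by `(1, 1)` lies outside the disc of radius `r + 1`. -/
theorem rotated_point_bounds {r s : ℝ} (hs : 1 ≤ s) (hr : 900 * s ^ 3 ≤ r) {u d : ℝ}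
    (hu : √2 * r - 1 - 2 * s < u) (hu' : u ≤ √2 * r - 1)
    (hd : √(2 * r ^ 2 - u ^ 2) - 2 * s < d) (hd' : d ≤ √(2 * r ^ 2 - u ^ 2)) :
    u ^ 2 + d ^ 2 ≤ 2 * r ^ 2 ∧ 2 * (r + 1) ^ 2 < (u + 2) ^ 2 + d ^ 2 ∧ 0 ≤ d ∧ d ≤ u := by
  have hs2 : s ≤ s ^ 2 := by nlinarith
  have hs3 : s ^ 2 ≤ s ^ 3 := by nlinarith [sq_nonneg s]
  have hw2 : (√2 * r) ^ 2 = 2 * r ^ 2 := by rw [mul_pow, Real.sq_sqrt (by norm_num)]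
  have hr0 : 0 < r := by linarith
  have hw : 1.4 * r ≤ √2 * r := by
    gcongr
    exact Real.le_sqrt_of_sq_le (by norm_num)
  have hw' : √2 * r ≤ 1.5 * r := by
    gcongr
    exact Real.sqrt_le_iff.2 (by norm_num)
  set w := √2 * r
  set t := √(2 * r ^ 2 - u ^ 2)
  have hu0 : 0 ≤ u := by linarith
  have hT : 1.4 * r ≤ 2 * r ^ 2 - u ^ 2 := by nlinarith
  have hT' : 2 * r ^ 2 - u ^ 2 ≤ 9 * s * r := by
    have h1 : (w - u) * (w + u) ≤ (3 * s) * (3 * r) :=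
      mul_le_mul (by linarith) (by linarith) (by linarith) (by linarith)
    nlinarith
  have ht0 : 0 ≤ t := Real.sqrt_nonneg _
  have ht2 : t ^ 2 = 2 * r ^ 2 - u ^ 2 := Real.sq_sqrt (by linarith)
  have hst : s * t ≤ 0.1 * r := by
    refine (sq_le_sq₀ (by positivity) (by positivity)).1 ?_
    have h1 : s ^ 2 * t ^ 2 ≤ s ^ 2 * (9 * s * r) := by
      rw [ht2]
      gcongr
    have h2 : 900 * s ^ 3 * r ≤ r * r := by gcongr
    linarith
  have htl : 2 * s ≤ t := Real.le_sqrt_of_sq_le (by nlinarith)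
  have htst : t ≤ s * t := by nlinarith
  refine ⟨by nlinarith, ?_, by linarith, by linarith⟩
  have : (t - 2 * s) ^ 2 ≤ d ^ 2 := by
    apply pow_le_pow_left₀ <;> linarith
  nlinarith

theorem stmt8 (s : ℕ) (hs : 0 < s) :
    ∃ r₀ : ℝ, ∀ r : ℝ, r₀ ≤ r → ∀ Δ : ℝ, 0 ≤ Δ → Δ ≤ 1 → ∀ i : ℤ,
      (∃ p ∈ Spat r Δ ((0, 0) : ℤ × ℤ) ((-1, -1) : ℤ × ℤ),
        0 ≤ p.1 ∧ 0 ≤ p.2 ∧ Int.ModEq (s : ℤ) (p.2 - p.1) i) ∧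
      (∃ q ∈ Spat r Δ ((0, 0) : ℤ × ℤ) ((-1, -1) : ℤ × ℤ),
        0 ≤ q.1 ∧ 0 ≤ q.2 ∧ Int.ModEq (s : ℤ) (q.1 + q.2) i) := by
  refine ⟨900 * (s : ℝ) ^ 3, fun r hr Δ hΔ hΔ' i => ?_⟩
  have hs1 : (1 : ℝ) ≤ s := by exact_mod_cast hs
  have hm : (0 : ℝ) < 2 * s := by linarith
  obtain ⟨k, hk, hk'⟩ := exists_int_residue_mem_Ioc i hm (√2 * r - 1)
  obtain ⟨l, hl, hl'⟩ := exists_int_residue_mem_Ioc i hm (√(2 * r ^ 2 - (i + 2 * s * k) ^ 2))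
  obtain ⟨h_in, h_out, hd0, hdu⟩ := rotated_point_bounds hs1 hr hk hk' hl hl'
  have hr0 : 0 ≤ r := le_trans (by positivity) hr
  have hx : (0 : ℤ) ≤ s * (k - l) := by
    have : (0 : ℝ) ≤ s * (k - l) := by linarith
    exact_mod_cast this
  have hy : (0 : ℤ) ≤ i + s * (k + l) := by
    have : (0 : ℝ) ≤ i + s * (k + l) := by linarith
    exact_mod_cast this
  have hmem : ((s * (k - l), i + s * (k + l)) : ℤ × ℤ) ∈ Spat r Δ (0, 0) (-1, -1) := by
    refine Or.inl ⟨?_, ?_⟩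
    · simp only [ball, Set.mem_ofPred_eq]
      push_cast
      linarith
    · simp only [ball, Set.mem_ofPred_eq, not_le]
      push_cast
      have : (r + Δ) ^ 2 ≤ (r + 1) ^ 2 := by gcongr
      linarith
  refine ⟨⟨_, hmem, hx, hy, ?_⟩, ⟨_, hmem, hx, hy, ?_⟩⟩
  · exact Int.modEq_iff_dvd.2 ⟨-2 * l, by ring⟩
  · exact Int.modEq_iff_dvd.2 ⟨-2 * k, by ring⟩
end

section
/- Let r be a positive integer and let Δ be a real number with 0 ≤ Δ < 1 and (r+Δ)² ≥ r² + 2r − 1. Then S_{r,Δ}((0,0),(−1,0)) = {(r,0), (−r−1,0)}; in particular |S_{r,Δ}((0,0),(−1,0))| = 2. -/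
open Filter

theorem sq_add_sq_le_and_lt_iff {r : ℕ} {Δ : ℝ} (hΔ0 : 0 ≤ Δ) (hΔ1 : Δ < 1)
    (h : ((r : ℝ) + Δ) ^ 2 ≥ (r : ℝ) ^ 2 + 2 * (r : ℝ) - 1) (x y : ℤ) :
    ((x : ℝ) ^ 2 + (y : ℝ) ^ 2 ≤ (r : ℝ) ^ 2 ∧
      ((r : ℝ) + Δ) ^ 2 < ((x : ℝ) + 1) ^ 2 + (y : ℝ) ^ 2) ↔ x = r ∧ y = 0 := by
  constructor
  · rintro ⟨hle, hlt⟩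
    have hx : (r : ℝ) < (x : ℝ) + 1 := by linarith
    have hxr : (r : ℤ) ≤ x := Int.lt_add_one_iff.mp (by exact_mod_cast hx)
    have hle' : x ^ 2 + y ^ 2 ≤ (r : ℤ) ^ 2 := by exact_mod_cast hle
    have hr : (0 : ℤ) ≤ r := Int.natCast_nonneg r
    have hy : y = 0 := by
      apply pow_eq_zero_iff two_ne_zero |>.mp
      nlinarith [sq_nonneg y]
    subst hy
    exact ⟨by nlinarith, rfl⟩
  · rintro ⟨rfl, rfl⟩
    have hr : (0 : ℝ) ≤ r := Nat.cast_nonneg r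
    push_cast
    constructor <;> nlinarith

theorem stmt10 (r : ℕ) (hr : 0 < r) (Δ : ℝ) (hΔ0 : 0 ≤ Δ) (hΔ1 : Δ < 1)
    (h : ((r : ℝ) + Δ) ^ 2 ≥ (r : ℝ) ^ 2 + 2 * (r : ℝ) - 1) :
    Spat (r : ℝ) Δ ((0, 0) : ℤ × ℤ) ((-1, 0) : ℤ × ℤ) =
        {((r : ℤ), 0), (-(r : ℤ) - 1, 0)} ∧
      Nat.card ↥(Spat (r : ℝ) Δ ((0, 0) : ℤ × ℤ) ((-1, 0) : ℤ × ℤ)) = 2 := by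
  have heq : Spat (r : ℝ) Δ ((0, 0) : ℤ × ℤ) ((-1, 0) : ℤ × ℤ) =
      {((r : ℤ), 0), (-(r : ℤ) - 1, 0)} := by
    ext ⟨x, y⟩
    have h₁ := sq_add_sq_le_and_lt_iff hΔ0 hΔ1 h x y
    have h₂ := sq_add_sq_le_and_lt_iff hΔ0 hΔ1 h (-x - 1) y
    have hx : -x - 1 = (r : ℤ) ↔ x = -(r : ℤ) - 1 := by omega
    have hsq : (-(x : ℝ) - 1) ^ 2 = ((x : ℝ) + 1) ^ 2 := by ring
    rw [hx] at h₂
    push_cast at h₂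
    rw [sub_add_cancel, neg_sq, hsq] at h₂
    simp only [Spat, ball, Set.mem_union, Set.mem_sdiff, Set.mem_ofPred_eq, not_le,
      Set.mem_insert_iff, Set.mem_singleton_iff, Prod.mk.injEq, sub_zero, sub_neg_eq_add,
      Int.cast_add, Int.cast_one]
    rw [h₁, h₂]
  refine ⟨heq, ?_⟩
  rw [heq, Nat.card_coe_set_eq, Set.ncard_pair]
  intro hpair
  have := congrArg Prod.fst hpair
  dsimp only at this
  omega
end
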